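/- The following network admits no scalar solution and no vector solution over any finite field; that is, for every finite field F_q and every k ≥ 1 there is no (k,k,k;k)-FNC solution (linear or nonlinear). Vertices: 1, 2, 3, 4', 4, 5, 6, 7. Node i has an input edge generating the message x_i for i = 1, 2, 3. Edges: 1→4', 2→4', 3→4', 4'→4, 4→5, 3→6, 4→6, 2→7, 4→7. Demands: node 5 demands x_1, node 6 demands x_2, node 7 demands x_3. -/

import Mathlib

open scoped Classical

structure Network where
  V : Type
  E : Type
  [fintV : Fintype V]
  [fintE : Fintype E]
  hd : E → V
  tl : E → V
  acyclic : ∃ f : V → ℕ, ∀ e : E, f (hd e) < f (tl e)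
  demand : V → Set E
  demand_isInput : ∀ v : V, ∀ e ∈ demand v, ∀ e' : E, tl e' ≠ hd e

namespace Network

variable (N : Network)

instance : Fintype N.V := N.fintV
instance : Fintype N.E := N.fintE

/-- An input edge: its head vertex has in-degree zero. -/
def IsInput (e : N.E) : Prop := ∀ e' : N.E, N.tl e' ≠ N.hd e

/-- The set of input edges, as a type. -/
abbrev InputEdge : Type := {e : N.E // N.IsInput e}

/-- The space of message tuples: input edge `i` generates a row vector of length `k i`. -/
abbrev MsgSpace (F : Type) (k : N.InputEdge → ℕ) : Type :=
  ∀ i : N.InputEdge, Fin (k i) → F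

/-- Incoming edges of a vertex. -/
def inSet (v : N.V) : Set N.E := {e | N.tl e = v}

/-- Outgoing intermediate edges of a vertex, together with its demands. -/
def outSet (v : N.V) : Set N.E :=
  {e | N.hd e = v ∧ ¬ N.IsInput e} ∪ N.demand v

/-- A `(k;n)`-fractional network coding solution over `F`.  The value carried by an input
edge is its message (condition (N1) is thus built in); `φ` gives the values carried by the
intermediate edges; `decode` is condition (N2) and `localEnc` is condition (N3). -/
structure FNCSol (F : Type) [Field F] (k : N.InputEdge → ℕ) (n : ℕ) where
  φ : ∀ e : N.E, ¬ N.IsInput e → N.MsgSpace F k → (Fin n → F)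
  decode : ∀ (v : N.V) (j : N.E) (hj : j ∈ N.demand v),
    ∃ χ : ((∀ i : {i : N.InputEdge // N.tl i.1 = v}, Fin (k i.1) → F) ×
           (∀ e : {e : N.E // N.tl e = v ∧ ¬ N.IsInput e}, Fin n → F)) →
          (Fin (k ⟨j, N.demand_isInput v j hj⟩) → F),
      ∀ x : N.MsgSpace F k,
        χ (fun i => x i.1, fun e => φ e.1 e.2.2 x) = x ⟨j, N.demand_isInput v j hj⟩
  localEnc : ∀ (e : N.E) (he : ¬ N.IsInput e),
    ∃ g : ((∀ i : {i : N.InputEdge // N.tl i.1 = N.hd e}, Fin (k i.1) → F) ×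
           (∀ e' : {e' : N.E // N.tl e' = N.hd e ∧ ¬ N.IsInput e'}, Fin n → F)) →
          (Fin n → F),
      ∀ x : N.MsgSpace F k, φ e he x = g (fun i => x i.1, fun e' => φ e'.1 e'.2.2 x)

/-- A solution is linear if all global encoding functions, all decoding functions and all
local encoding functions are `F`-linear. -/
def FNCSol.IsLinear {N : Network} {F : Type} [Field F] {k : N.InputEdge → ℕ} {n : ℕ}
    (sol : N.FNCSol F k n) : Prop :=
  (∀ (e : N.E) (he : ¬ N.IsInput e), IsLinearMap F (sol.φ e he)) ∧
  (∀ (v : N.V) (j : N.E) (hj : j ∈ N.demand v),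
    ∃ χ : ((∀ i : {i : N.InputEdge // N.tl i.1 = v}, Fin (k i.1) → F) ×
           (∀ e : {e : N.E // N.tl e = v ∧ ¬ N.IsInput e}, Fin n → F)) →
          (Fin (k ⟨j, N.demand_isInput v j hj⟩) → F),
      IsLinearMap F χ ∧
      ∀ x : N.MsgSpace F k,
        χ (fun i => x i.1, fun e => sol.φ e.1 e.2.2 x) = x ⟨j, N.demand_isInput v j hj⟩) ∧
  (∀ (e : N.E) (he : ¬ N.IsInput e),
    ∃ g : ((∀ i : {i : N.InputEdge // N.tl i.1 = N.hd e}, Fin (k i.1) → F) ×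
           (∀ e' : {e' : N.E // N.tl e' = N.hd e ∧ ¬ N.IsInput e'}, Fin n → F)) →
          (Fin n → F),
      IsLinearMap F g ∧
      ∀ x : N.MsgSpace F k, sol.φ e he x = g (fun i => x i.1, fun e' => sol.φ e'.1 e'.2.2 x))

end Network

/-- The network of Fig. 8.  Vertices `0,1,2` are auxiliary sources; `3,4,5` are the nodes
`1,2,3` receiving the input edges generating `x_1,x_2,x_3`; `6,7` are `4',4`; and
`8,9,10` are the demanding nodes `5,6,7`. -/
def fncNet : Network where
  V := Fin 11
  E := Fin 12
  hd := ![0,1,2,3,4,5,6,7,5,7,4,7]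
  tl := ![3,4,5,6,6,6,7,8,9,9,10,10]
  acyclic := ⟨![0,0,0,1,1,1,2,3,4,4,4], by decide⟩
  demand := fun v => {e | (v = 8 ∧ e = 0) ∨ (v = 9 ∧ e = 1) ∨ (v = 10 ∧ e = 2)}
  demand_isInput := by
    intro v e he e'
    rcases he with ⟨_, rfl⟩|⟨_, rfl⟩|⟨_, rfl⟩ <;> (revert e'; decide)

namespace Network

variable {N : Network} {F : Type} [Field F] {k : N.InputEdge → ℕ} {n : ℕ}

/-- Two message tuples carry the same data into the vertex `v`. -/
def FNCSol.Agree (sol : N.FNCSol F k n) (x y : N.MsgSpace F k) (v : N.V) : Prop :=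
  (∀ i : N.InputEdge, N.tl i.1 = v → x i = y i) ∧
    ∀ (e : N.E) (he : ¬ N.IsInput e), N.tl e = v → sol.φ e he x = sol.φ e he y

/-- The data arriving at the vertex `v`. -/
def FNCSol.received (sol : N.FNCSol F k n) (v : N.V) (x : N.MsgSpace F k) :
    (∀ i : {i : N.InputEdge // N.tl i.1 = v}, Fin (k i.1) → F) ×
      ({e : N.E // N.tl e = v ∧ ¬ N.IsInput e} → Fin n → F) :=
  (fun i => x i.1, fun e => sol.φ e.1 e.2.2 x)

theorem FNCSol.Agree.received_eq {sol : N.FNCSol F k n} {x y : N.MsgSpace F k} {v : N.V}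
    (h : sol.Agree x y v) : sol.received v x = sol.received v y :=
  Prod.ext (funext fun i => h.1 i.1 i.2) (funext fun e => h.2 e.1 e.2.2 e.2.1)

theorem FNCSol.Agree.edge_eq {sol : N.FNCSol F k n} {x y : N.MsgSpace F k} {e : N.E}
    (h : sol.Agree x y (N.hd e)) (he : ¬ N.IsInput e) : sol.φ e he x = sol.φ e he y := by
  obtain ⟨g, hg⟩ := sol.localEnc e he
  exact (hg x).trans ((congrArg g h.received_eq).trans (hg y).symm)

theorem FNCSol.Agree.demand_eq {sol : N.FNCSol F k n} {x y : N.MsgSpace F k} {v : N.V}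
    (h : sol.Agree x y v) {j : N.E} (hj : j ∈ N.demand v) :
    x ⟨j, N.demand_isInput v j hj⟩ = y ⟨j, N.demand_isInput v j hj⟩ := by
  obtain ⟨χ, hχ⟩ := sol.decode v j hj
  exact (hχ x).symm.trans ((congrArg χ h.received_eq).trans (hχ y))

end Network

theorem fncNet_isInput_iff (e : Fin 12) : fncNet.IsInput e ↔ e = 0 ∨ e = 1 ∨ e = 2 := by
  change (∀ e' : Fin 12, (![3,4,5,6,6,6,7,8,9,9,10,10] : Fin 12 → Fin 11) e' ≠
    (![0,1,2,3,4,5,6,7,5,7,4,7] : Fin 12 → Fin 11) e) ↔ _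
  revert e
  decide

theorem fncNet_not_isInput {e : Fin 12} (he : 2 < e) : ¬ fncNet.IsInput e := by
  rw [fncNet_isInput_iff]
  revert e
  decide

/-- Agreement at `v` only has to be checked on a list of edges containing those entering `v`. -/
theorem fncNet_agree {F : Type} [Field F] {k : fncNet.InputEdge → ℕ} {n : ℕ}
    {sol : fncNet.FNCSol F k n} {x y : fncNet.MsgSpace F k} {v : Fin 11} (l : List (Fin 12))
    (hl : ∀ e : Fin 12, (![3,4,5,6,6,6,7,8,9,9,10,10] : Fin 12 → Fin 11) e = v → e ∈ l)
    (h_input : ∀ e ∈ l, ∀ he : fncNet.IsInput e, x ⟨e, he⟩ = y ⟨e, he⟩)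
    (h_edge : ∀ e ∈ l, ∀ he : ¬ fncNet.IsInput e, sol.φ e he x = sol.φ e he y) :
    sol.Agree x y v :=
  ⟨fun i hi => h_input i.1 (hl i.1 hi) i.2, fun e he hv => h_edge e (hl e hv) he⟩

/-- **Lemma 4(1).** The network of Fig. 8 admits no scalar and no vector solution (linear
or nonlinear) over any finite field: for every `k ≥ 1` there is no `(k,k,k;k)`-FNC
solution. -/
theorem fncNet_no_vector_solution
    (F : Type) [Field F] [Fintype F] (k : ℕ) (hk : 0 < k) :
    ¬ Nonempty (fncNet.FNCSol F (fun _ => k) k) := by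
  rintro ⟨sol⟩
  have h6 : ¬ fncNet.IsInput (6 : Fin 12) := fncNet_not_isInput (by decide)
  have h0 : fncNet.IsInput (0 : Fin 12) := (fncNet_isInput_iff 0).2 (by decide)
  have h1 : fncNet.IsInput (1 : Fin 12) := (fncNet_isInput_iff 1).2 (by decide)
  have h_seven (x y) (h : sol.φ (6 : Fin 12) h6 x = sol.φ (6 : Fin 12) h6 y) :
      sol.Agree x y (7 : Fin 11) := by
    refine fncNet_agree [6] (by decide) ?_ ?_
    · simpa using fun he => absurd he h6
    · simpa using fun _ => h
  -- The value on the bottleneck edge determines the first message.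
  have h_first (x y) (h : sol.φ (6 : Fin 12) h6 x = sol.φ (6 : Fin 12) h6 y) :
      x ⟨(0 : Fin 12), h0⟩ = y ⟨(0 : Fin 12), h0⟩ := by
    have h7 : ¬ fncNet.IsInput (7 : Fin 12) := fncNet_not_isInput (by decide)
    have h_agree : sol.Agree x y (8 : Fin 11) := by
      refine fncNet_agree [7] (by decide) ?_ ?_
      · simpa using fun he => absurd he h7
      · simpa using (h_seven x y h).edge_eq (N := fncNet) (e := (7 : Fin 12))
    exact h_agree.demand_eq (j := (0 : Fin 12)) (Or.inl ⟨rfl, rfl⟩)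
  -- By counting, the first message also determines that value.
  have h_bottleneck (x y : fncNet.MsgSpace F fun _ => k)
      (h : x ⟨(0 : Fin 12), h0⟩ = y ⟨(0 : Fin 12), h0⟩) :
      sol.φ (6 : Fin 12) h6 x = sol.φ (6 : Fin 12) h6 y := by
    let first : (fncNet.MsgSpace F fun _ => k) → (Fin k → F) := fun x => x ⟨(0 : Fin 12), h0⟩
    have h_factors : first.FactorsThrough (sol.φ (6 : Fin 12) h6) :=
      fun x y hxy => h_first x y hxy
    let χ : (Fin k → F) → (Fin k → F) := Function.extend (sol.φ (6 : Fin 12) h6) first 0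
    have hχ (x) : χ (sol.φ (6 : Fin 12) h6 x) = first x := h_factors.extend_apply 0 x
    have h_surj : Function.Surjective χ := fun a =>
      ⟨sol.φ (6 : Fin 12) h6 fun _ => a, hχ fun _ => a⟩
    exact Finite.injective_iff_surjective.2 h_surj (by rw [hχ, hχ]; exact h)
  let x : fncNet.MsgSpace F fun _ => k := fun _ => 0
  let y : fncNet.MsgSpace F fun _ => k := Function.update x ⟨(1 : Fin 12), h1⟩ fun _ => 1
  have h_off (e : Fin 12) (he : fncNet.IsInput e) (hne : e ≠ 1) : x ⟨e, he⟩ = y ⟨e, he⟩ :=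
    (Function.update_of_ne (fun h => hne (congrArg Subtype.val h)) _ x).symm
  have h_five : sol.Agree x y (5 : Fin 11) := by
    refine fncNet_agree [2] (by decide) ?_ ?_
    · simpa using fun he => h_off 2 he (by decide)
    · simpa using fun he => absurd ((fncNet_isInput_iff 2).2 (by decide)) he
  have h_six : sol.φ (6 : Fin 12) h6 x = sol.φ (6 : Fin 12) h6 y :=
    h_bottleneck x y (h_off 0 h0 (by decide))
  have h_nine : sol.Agree x y (9 : Fin 11) := by
    refine fncNet_agree [8, 9] (by decide) ?_ ?_
    · intro e he hin
      refine h_off e hin ?_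
      rintro rfl
      revert he
      decide
    · simpa using ⟨h_five.edge_eq (N := fncNet) (e := (8 : Fin 12)),
        (h_seven x y h_six).edge_eq (N := fncNet) (e := (9 : Fin 12))⟩
  have h_eq := h_nine.demand_eq (j := (1 : Fin 12)) (Or.inr (Or.inl ⟨rfl, rfl⟩))
  have h_zero_one : (0 : F) = 1 := by
    have h_y : y ⟨(1 : Fin 12), h1⟩ = fun _ => 1 := Function.update_self _ _ x
    exact congrFun (h_eq.trans h_y) ⟨0, hk⟩
  exact zero_ne_one h_zero_one
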